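/- For every n≥1 and every τ in the upper half-plane, the function (z₁,…,z_{2n}) ↦ P_n^{(1)}(z₁,…,z_{2n};τ) is not identically zero on ℂ^{2n}. -/

import Mathlib

open Complex BigOperators Finset

noncomputable section

def qpoch (a p : ℂ) : ℂ := ∏' j : ℕ, (1 - a * p ^ j)

def theta (x p : ℂ) : ℂ := qpoch x p * qpoch (p / x) p

def pf {m : ℕ} (A : Matrix (Fin (2 * m)) (Fin (2 * m)) ℂ) : ℂ :=
  (1 / (2 ^ m * (Nat.factorial m) : ℂ)) *
    ∑ σ : Equiv.Perm (Fin (2 * m)), ((Equiv.Perm.sign σ : ℤ) : ℂ) *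
      ∏ j : Fin m, A (σ ⟨2 * (j : ℕ), by have := j.isLt; omega⟩)
        (σ ⟨2 * (j : ℕ) + 1, by have := j.isLt; omega⟩)

def pPow (τ lam : ℂ) : ℂ := Complex.exp (Real.pi * Complex.I * τ * lam)

def xOf (z : ℂ) : ℂ := Complex.exp (Real.pi * Complex.I * z)

def P1 (n : ℕ) (τ : ℂ) (z : Fin (2 * n) → ℂ) : ℂ :=
  let p : ℂ → ℂ := fun lam => pPow τ lam
  let x : Fin (2 * n) → ℂ := fun j => xOf (z j)
  (∏ i, ∏ j, if i < j then
      (x j) ^ 3 / (x i) ^ 3 * theta (-((x i) ^ 6 / (x j) ^ 6)) (p 6) else 1) *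
  pf (fun i j => x i / x j *
      theta ((x i) ^ 2 / (x j) ^ 2) (p 2) * theta (-((x i) ^ 2 / (x j) ^ 2)) (p 2) *
      theta (p 1 * ((x i) ^ 2 / (x j) ^ 2)) (p 2) /
      theta (-((x i) ^ 6 / (x j) ^ 6)) (p 6))

open Filter Topology

section Theta

variable {p : ℂ}

theorem summable_norm_neg_mul_pow (hp : ‖p‖ < 1) (a : ℂ) :
    Summable fun j : ℕ => ‖-(a * p ^ j)‖ := by
  simp only [norm_neg, norm_mul, norm_pow]
  exact (summable_geometric_of_lt_one (norm_nonneg _) hp).mul_left _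

theorem qpoch_eq_one_sub_mul (hp : ‖p‖ < 1) (a : ℂ) :
    qpoch a p = (1 - a) * qpoch (p * a) p := by
  have h : Multipliable fun j : ℕ => 1 - p * a * p ^ j := by
    simpa only [sub_eq_add_neg] using
      multipliable_one_add_of_summable (summable_norm_neg_mul_pow hp (p * a))
  have hshift : ∀ j : ℕ, 1 - a * p ^ (j + 1) = 1 - p * a * p ^ j := fun j => by ring
  unfold qpoch
  rw [tprod_eq_zero_mul' (by simpa only [hshift] using h)]
  simp only [hshift, pow_zero, mul_one]

theorem qpoch_ne_zero (hp : ‖p‖ < 1) {a : ℂ} (ha : ‖a‖ < 1) : qpoch a p ≠ 0 := by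
  unfold qpoch
  simp only [sub_eq_add_neg]
  refine tprod_one_add_ne_zero_of_summable (fun j h => ?_) (summable_norm_neg_mul_pow hp a)
  have h1 : a * p ^ j = 1 := by linear_combination -h
  have h2 : ‖a * p ^ j‖ < 1 := by
    rw [norm_mul, norm_pow]
    exact mul_lt_one_of_nonneg_of_lt_one_left (norm_nonneg _) ha
      (pow_le_one₀ (norm_nonneg _) hp.le)
  simp [h1] at h2

theorem continuous_qpoch (hp : ‖p‖ < 1) : Continuous fun a => qpoch a p := by
  refine continuous_iff_continuousAt.2 fun a => ?_
  have hmem : Metric.ball (0 : ℂ) (‖a‖ + 1) ∈ 𝓝 a :=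
    Metric.isOpen_ball.mem_nhds (by simp)
  have h := Summable.hasProdLocallyUniformlyOn_nat_one_add
    (f := fun (j : ℕ) (a : ℂ) => -(a * p ^ j)) (K := Metric.ball (0 : ℂ) (‖a‖ + 1))
    Metric.isOpen_ball
    ((summable_geometric_of_lt_one (norm_nonneg _) hp).mul_left (‖a‖ + 1))
    (.of_forall fun j b hb => by
      rw [norm_neg, norm_mul, norm_pow]
      have hb' : ‖b‖ < ‖a‖ + 1 := by simpa using hb
      gcongr)
    (fun j => by fun_prop)
  have hcont := h.continuousOn (.of_forall fun s => by fun_prop)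
  simpa only [qpoch, sub_eq_add_neg] using hcont.continuousAt hmem

theorem continuous_theta_comp {α : Type*} [TopologicalSpace α] (hp : ‖p‖ < 1) {f : α → ℂ}
    (hf : Continuous f) (hf0 : ∀ t, f t ≠ 0) : Continuous fun t => theta (f t) p :=
  ((continuous_qpoch hp).comp hf).mul
    ((continuous_qpoch hp).comp (continuous_const.div hf hf0))

theorem theta_inv (hp : ‖p‖ < 1) {x : ℂ} (hx : x ≠ 0) : theta x⁻¹ p = -x⁻¹ * theta x p := by
  unfold theta
  rw [qpoch_eq_one_sub_mul hp x⁻¹, qpoch_eq_one_sub_mul hp x, div_inv_eq_mul, div_eq_mul_inv]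
  field_simp
  ring

theorem theta_eq_zero_iff_of_norm_eq_one (hp : ‖p‖ < 1) {x : ℂ} (hx : ‖x‖ = 1) :
    theta x p = 0 ↔ x = 1 := by
  unfold theta
  rw [qpoch_eq_one_sub_mul hp x, mul_eq_zero, mul_eq_zero, sub_eq_zero, eq_comm (a := x)]
  have h1 : qpoch (p * x) p ≠ 0 := qpoch_ne_zero hp (by simpa [hx] using hp)
  have h2 : qpoch (p / x) p ≠ 0 := qpoch_ne_zero hp (by simpa [hx] using hp)
  simp [h1, h2]

theorem theta_mul_sq_inv (hp0 : p ≠ 0) (x : ℂ) :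
    theta (p * x⁻¹) (p ^ 2) = theta (p * x) (p ^ 2) := by
  have h1 : p ^ 2 / (p * x⁻¹) = p * x := by field_simp
  have h2 : p ^ 2 / (p * x) = p * x⁻¹ := by
    rw [sq, mul_div_mul_left _ _ hp0, div_eq_mul_inv]
  rw [theta, theta, h1, h2, mul_comm]

theorem theta_mul_sq_ne_zero (hp0 : p ≠ 0) (hp : ‖p‖ < 1) {x : ℂ} (hx : ‖x‖ = 1) :
    theta (p * x) (p ^ 2) ≠ 0 := by
  have hp2 : ‖p ^ 2‖ < 1 := by
    rw [norm_pow]; exact pow_lt_one₀ (norm_nonneg _) hp two_ne_zero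
  have h2 : p ^ 2 / (p * x) = p / x := by rw [sq, mul_div_mul_left _ _ hp0]
  rw [theta, h2]
  exact mul_ne_zero (qpoch_ne_zero hp2 (by simpa [hx] using hp))
    (qpoch_ne_zero hp2 (by simpa [hx] using hp))

end Theta

section Pfaffian

/-- The block diagonal matrix with `m` diagonal blocks `!![0, 1; -1, 0]`. -/
def blockSymplectic {m : ℕ} (a b : Fin m × Fin 2) : ℤ :=
  if a.1 = b.1 then (if a.2 < b.2 then 1 else if b.2 < a.2 then -1 else 0) else 0

theorem sign_mul_prod_blockSymplectic {m : ℕ} (σ : Equiv.Perm (Fin m × Fin 2)) :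
    (Equiv.Perm.sign σ : ℤ) * ∏ j : Fin m, blockSymplectic (σ (j, 0)) (σ (j, 1)) =
      if ∀ j, (σ (j, 0)).1 = (σ (j, 1)).1 then 1 else 0 := by
  split_ifs with h
  · have hsame : ∀ j b, (σ (j, b)).1 = (σ (j, 0)).1 := by
      intro j b; fin_cases b
      · rfl
      · exact (h j).symm
    have hsurj : Function.Surjective (fun j => (σ (j, 0)).1) := by
      intro k
      refine ⟨(σ.symm (k, 0)).1, ?_⟩
      show (σ ((σ.symm (k, 0)).1, 0)).1 = k
      rw [← hsame _ (σ.symm (k, 0)).2]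
      simp
    let π : Equiv.Perm (Fin m) := Equiv.ofBijective _ (Finite.surjective_iff_bijective.1 hsurj)
    have hinj : ∀ j, Function.Injective (fun b => (σ (j, b)).2) := by
      intro j b c hbc
      have : σ (j, b) = σ (j, c) := Prod.ext ((hsame j b).trans (hsame j c).symm) hbc
      simpa using σ.injective this
    let e : Fin m → Equiv.Perm (Fin 2) := fun j =>
      Equiv.ofBijective _ (Finite.injective_iff_bijective.1 (hinj j))
    have hval : ∀ j b, σ (j, b) = (π j, e j b) := fun j b => Prod.ext (hsame j b) rfl
    have hσ : σ = Equiv.prodCongrLeft (fun _ : Fin 2 => π) * Equiv.prodCongrRight e := by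
      ext1 ⟨j, b⟩
      exact hval j b
    have hsign : Equiv.Perm.sign σ = ∏ j, Equiv.Perm.sign (e j) := by
      rw [hσ, map_mul, Equiv.Perm.sign_prodCongrLeft, Equiv.Perm.sign_prodCongrRight]
      simp
    have hsign₂ : ∀ g : Equiv.Perm (Fin 2),
        (if g 0 < g 1 then 1 else if g 1 < g 0 then -1 else 0 : ℤ) = Equiv.Perm.sign g := by
      decide
    have hblock : ∀ (k : Fin m) (g : Equiv.Perm (Fin 2)),
        blockSymplectic (k, g 0) (k, g 1) = Equiv.Perm.sign g := fun k g => by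
      simpa [blockSymplectic] using hsign₂ g
    simp_rw [hval, hblock, hsign]
    push_cast
    rw [← Finset.prod_mul_distrib]
    refine Finset.prod_eq_one fun j _ => ?_
    rcases Int.units_eq_one_or (Equiv.Perm.sign (e j)) with h | h <;> simp [h]
  · push Not at h
    obtain ⟨j, hj⟩ := h
    rw [Finset.prod_eq_zero (Finset.mem_univ j) (by simp [blockSymplectic, hj]), mul_zero]

/-- The indexing of `Fin (2 * m)` by consecutive pairs: `(j, b)` corresponds to `2 * j + b`. -/
def pairIndex (m : ℕ) : Fin m × Fin 2 ≃ Fin (2 * m) :=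
  finProdFinEquiv.trans (finCongr (mul_comm m 2))

theorem pf_eq_sum_pairIndex {m : ℕ} (A : Matrix (Fin (2 * m)) (Fin (2 * m)) ℂ) :
    pf A = (1 / (2 ^ m * (Nat.factorial m) : ℂ)) *
      ∑ σ : Equiv.Perm (Fin m × Fin 2), ((Equiv.Perm.sign σ : ℤ) : ℂ) *
        ∏ j : Fin m, A (pairIndex m (σ (j, 0))) (pairIndex m (σ (j, 1))) := by
  unfold pf
  rw [← Equiv.sum_comp (pairIndex m).permCongr]
  congr 1
  refine Finset.sum_congr rfl fun σ _ => ?_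
  rw [Equiv.Perm.sign_permCongr]
  congr 1
  refine Finset.prod_congr rfl fun j _ => ?_
  have h0 : (⟨2 * (j : ℕ), by have := j.isLt; omega⟩ : Fin (2 * m)) = pairIndex m (j, 0) :=
    Fin.ext (by simp [pairIndex])
  have h1 : (⟨2 * (j : ℕ) + 1, by have := j.isLt; omega⟩ : Fin (2 * m)) = pairIndex m (j, 1) :=
    Fin.ext (by simp [pairIndex, add_comm])
  rw [h0, h1]
  simp [Equiv.permCongr_apply]

theorem eventually_pf_ne_zero {α : Type*} {l : Filter α} {m : ℕ}
    {A : α → Matrix (Fin (2 * m)) (Fin (2 * m)) ℂ} {r : α → ℂ}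
    (h : ∀ a b, Tendsto (fun t => r t * A t (pairIndex m a) (pairIndex m b)) l
      (𝓝 (blockSymplectic a b))) :
    ∀ᶠ t in l, pf (A t) ≠ 0 := by
  have hlim : Tendsto (fun t => r t ^ m * pf (A t)) l
      (𝓝 ((1 / (2 ^ m * (Nat.factorial m) : ℂ)) *
        ∑ σ : Equiv.Perm (Fin m × Fin 2), ((Equiv.Perm.sign σ : ℤ) : ℂ) *
          ∏ j : Fin m, (blockSymplectic (σ (j, 0)) (σ (j, 1)) : ℂ))) := by
    have heq : ∀ t, r t ^ m * pf (A t) = (1 / (2 ^ m * (Nat.factorial m) : ℂ)) *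
        ∑ σ : Equiv.Perm (Fin m × Fin 2), ((Equiv.Perm.sign σ : ℤ) : ℂ) *
          ∏ j : Fin m, (r t * A t (pairIndex m (σ (j, 0))) (pairIndex m (σ (j, 1)))) := by
      intro t
      simp only [pf_eq_sum_pairIndex, Finset.prod_mul_distrib, Finset.prod_const,
        Finset.card_univ, Fintype.card_fin, Finset.mul_sum]
      exact Finset.sum_congr rfl fun σ _ => by ring
    simp only [heq]
    exact (tendsto_finsetSum _ fun σ _ =>
      (tendsto_finsetProd _ fun j _ => h _ _).const_mul _).const_mul _
  have hne : (1 / (2 ^ m * (Nat.factorial m) : ℂ)) *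
      ∑ σ : Equiv.Perm (Fin m × Fin 2), ((Equiv.Perm.sign σ : ℤ) : ℂ) *
        ∏ j : Fin m, (blockSymplectic (σ (j, 0)) (σ (j, 1)) : ℂ) ≠ 0 := by
    refine mul_ne_zero (one_div_ne_zero (mul_ne_zero (by simp)
      (by exact_mod_cast m.factorial_ne_zero))) ?_
    have hpos : (0 : ℤ) < ∑ σ : Equiv.Perm (Fin m × Fin 2), (Equiv.Perm.sign σ : ℤ) *
        ∏ j : Fin m, blockSymplectic (σ (j, 0)) (σ (j, 1)) := by
      simp only [sign_mul_prod_blockSymplectic]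
      refine Finset.sum_pos' (fun σ _ => by split_ifs <;> simp) ⟨1, Finset.mem_univ _, by simp⟩
    exact_mod_cast hpos.ne'
  exact (hlim.eventually_ne hne).mono fun t ht h0 => ht (by rw [h0, mul_zero])

end Pfaffian

section Entries

variable {τ : ℂ}

theorem norm_xOf (s : ℝ) : ‖xOf s‖ = 1 := by
  rw [xOf, show (Real.pi : ℂ) * I * s = ((Real.pi * s : ℝ) : ℂ) * I by push_cast; ring]
  exact norm_exp_ofReal_mul_I _

theorem xOf_ne_zero (z : ℂ) : xOf z ≠ 0 := exp_ne_zero _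

theorem xOf_sub (z w : ℂ) : xOf (z - w) = xOf z / xOf w := by
  rw [xOf, xOf, xOf, ← exp_sub]; ring_nf

theorem xOf_neg (z : ℂ) : xOf (-z) = (xOf z)⁻¹ := by
  rw [xOf, xOf, ← exp_neg]; ring_nf

theorem continuous_xOf_ofReal : Continuous fun s : ℝ => xOf s := by
  unfold xOf; fun_prop

theorem norm_pPow_lt_one (hτ : 0 < τ.im) {k : ℝ} (hk : 0 < k) : ‖pPow τ k‖ < 1 := by
  rw [pPow, norm_exp, Real.exp_lt_one_iff]
  have : (Real.pi * I * τ * (k : ℂ)).re = -(Real.pi * τ.im * k) := by simp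
  rw [this]
  have := Real.pi_pos
  exact neg_neg_of_pos (by positivity)

theorem norm_pPow_six_lt_one (hτ : 0 < τ.im) : ‖pPow τ 6‖ < 1 := by
  exact_mod_cast norm_pPow_lt_one hτ (k := 6) (by norm_num)

theorem norm_pPow_two_lt_one (hτ : 0 < τ.im) : ‖pPow τ 2‖ < 1 := by
  exact_mod_cast norm_pPow_lt_one hτ (k := 2) (by norm_num)

theorem norm_pPow_one_lt_one (hτ : 0 < τ.im) : ‖pPow τ 1‖ < 1 := by
  exact_mod_cast norm_pPow_lt_one hτ (k := 1) (by norm_num)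

theorem pPow_two (τ : ℂ) : pPow τ 2 = pPow τ 1 ^ 2 := by
  rw [pPow, pPow, ← exp_nat_mul]; push_cast; ring_nf

/-- The numerator of the pfaffian entry, as a function of `z_i - z_j`. -/
def entryNum (τ : ℂ) (s : ℝ) : ℂ :=
  xOf s * theta (xOf s ^ 2) (pPow τ 2) * theta (-(xOf s ^ 2)) (pPow τ 2) *
    theta (pPow τ 1 * xOf s ^ 2) (pPow τ 2)

/-- The denominator of the pfaffian entry, as a function of `z_i - z_j`. -/
def entryDen (τ : ℂ) (s : ℝ) : ℂ := theta (-(xOf s ^ 6)) (pPow τ 6)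

theorem continuous_entryNum (hτ : 0 < τ.im) : Continuous (entryNum τ) := by
  have h2 := norm_pPow_two_lt_one hτ
  have hx := continuous_xOf_ofReal
  exact ((hx.mul (continuous_theta_comp h2 (hx.pow 2) fun s => pow_ne_zero 2 (xOf_ne_zero s))).mul
    (continuous_theta_comp h2 (hx.pow 2).neg fun s =>
      neg_ne_zero.2 (pow_ne_zero 2 (xOf_ne_zero s)))).mul
    (continuous_theta_comp h2 (continuous_const.mul (hx.pow 2)) fun s =>
      mul_ne_zero (exp_ne_zero _) (pow_ne_zero 2 (xOf_ne_zero s)))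

theorem continuous_entryDen (hτ : 0 < τ.im) : Continuous (entryDen τ) :=
  continuous_theta_comp (norm_pPow_six_lt_one hτ) (continuous_xOf_ofReal.pow 6).neg fun s =>
    neg_ne_zero.2 (pow_ne_zero 6 (xOf_ne_zero s))

theorem entryDen_neg (hτ : 0 < τ.im) (s : ℝ) :
    entryDen τ (-s) = (xOf s ^ 6)⁻¹ * entryDen τ s := by
  have hx := xOf_ne_zero s
  rw [entryDen, entryDen, ofReal_neg, xOf_neg, inv_pow, ← inv_neg,
    theta_inv (norm_pPow_six_lt_one hτ) (neg_ne_zero.2 (pow_ne_zero 6 hx)), inv_neg, neg_neg]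

theorem entryNum_neg (hτ : 0 < τ.im) (s : ℝ) :
    entryNum τ (-s) = -((xOf s ^ 6)⁻¹ * entryNum τ s) := by
  have hx := xOf_ne_zero s
  have h2 := norm_pPow_two_lt_one hτ
  have h3 : theta (pPow τ 1 * (xOf s ^ 2)⁻¹) (pPow τ 2) =
      theta (pPow τ 1 * xOf s ^ 2) (pPow τ 2) := by
    rw [pPow_two]; exact theta_mul_sq_inv (exp_ne_zero _) _
  rw [entryNum, entryNum, ofReal_neg, xOf_neg, inv_pow, h3, ← inv_neg,
    theta_inv h2 (pow_ne_zero 2 hx), theta_inv h2 (neg_ne_zero.2 (pow_ne_zero 2 hx))]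
  field_simp

theorem entryNum_div_entryDen_neg (hτ : 0 < τ.im) (s : ℝ) :
    entryNum τ (-s) / entryDen τ (-s) = -(entryNum τ s / entryDen τ s) := by
  rw [entryNum_neg hτ, entryDen_neg hτ, neg_div,
    mul_div_mul_left _ _ (inv_ne_zero (pow_ne_zero 6 (xOf_ne_zero s)))]

theorem entryDen_eq_zero_iff (hτ : 0 < τ.im) (s : ℝ) :
    entryDen τ s = 0 ↔ ∃ k : ℤ, 6 * s = 2 * k + 1 := by
  rw [entryDen, theta_eq_zero_iff_of_norm_eq_one (norm_pPow_six_lt_one hτ)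
    (by rw [norm_neg, norm_pow, norm_xOf, one_pow]), xOf, ← exp_nat_mul,
    show -cexp ((6 : ℕ) * (Real.pi * I * s)) = cexp (Real.pi * I * (6 * s - 1)) by
      rw [mul_sub, exp_sub, mul_one, exp_pi_mul_I]; push_cast; ring_nf, exp_eq_one_iff]
  refine exists_congr fun k => ?_
  have hpi : (Real.pi : ℂ) * I ≠ 0 := mul_ne_zero (by exact_mod_cast Real.pi_ne_zero) I_ne_zero
  rw [show (k : ℂ) * (2 * Real.pi * I) = Real.pi * I * (2 * k) by ring, mul_right_inj' hpi,
    sub_eq_iff_eq_add]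
  exact_mod_cast Iff.rfl

theorem entryDen_sixth (hτ : 0 < τ.im) : entryDen τ (1 / 6) = 0 :=
  (entryDen_eq_zero_iff hτ _).2 ⟨0, by norm_num⟩

theorem entryNum_sixth_ne_zero (hτ : 0 < τ.im) : entryNum τ (1 / 6) ≠ 0 := by
  have h2 := norm_pPow_two_lt_one hτ
  set x := xOf ((1 / 6 : ℝ) : ℂ) with hx
  have hnorm : ‖x ^ 2‖ = 1 := by rw [norm_pow, norm_xOf, one_pow]
  have hcube : (x ^ 2) ^ 3 = -1 := by
    rw [← pow_mul, hx, xOf, ← exp_nat_mul, ← exp_pi_mul_I]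
    push_cast; ring_nf
  have hne1 : x ^ 2 ≠ 1 := fun h => by norm_num [h] at hcube
  have hne2 : -(x ^ 2) ≠ 1 := fun h => by
    rw [hx, xOf, ← exp_nat_mul, neg_eq_iff_eq_neg, ← exp_pi_mul_I, exp_eq_exp_iff_exists_int] at h
    obtain ⟨k, hk⟩ := h
    have hpi : (Real.pi : ℂ) * I ≠ 0 :=
      mul_ne_zero (by exact_mod_cast Real.pi_ne_zero) I_ne_zero
    have h3 : (Real.pi : ℂ) * I * (-2) = Real.pi * I * (6 * k) := by
      push_cast at hk
      linear_combination 3 * hk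
    have h4 : (-2 : ℤ) = 6 * k := by exact_mod_cast mul_left_cancel₀ hpi h3
    omega
  refine mul_ne_zero (mul_ne_zero (mul_ne_zero (xOf_ne_zero _) ?_) ?_) ?_
  · rwa [Ne, theta_eq_zero_iff_of_norm_eq_one h2 hnorm]
  · rwa [Ne, theta_eq_zero_iff_of_norm_eq_one h2 (by rwa [norm_neg])]
  · rw [pPow_two]
    exact theta_mul_sq_ne_zero (exp_ne_zero _) (norm_pPow_one_lt_one hτ) hnorm

theorem eventually_entryDen_sixth_add_ne_zero (hτ : 0 < τ.im) :
    ∀ᶠ t : ℝ in 𝓝[≠] 0, entryDen τ (1 / 6 + t) ≠ 0 := by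
  have hsmall : ∀ᶠ t : ℝ in 𝓝[≠] 0, t ∈ Set.Ioo (-(1 / 6) : ℝ) (1 / 6) :=
    mem_nhdsWithin_of_mem_nhds (Ioo_mem_nhds (by norm_num) (by norm_num))
  filter_upwards [hsmall, self_mem_nhdsWithin] with t ht ht0 h
  obtain ⟨k, hk⟩ := (entryDen_eq_zero_iff hτ _).1 h
  have h1 : (k : ℝ) < 1 := by linarith [ht.2]
  have h2 : (-1 : ℝ) < k := by linarith [ht.1]
  have hk0 : k = 0 := by
    have h1' : k < 1 := by exact_mod_cast h1
    have h2' : -1 < k := by exact_mod_cast h2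
    omega
  rw [hk0] at hk
  exact ht0 (by simp at hk; simp; linarith)

theorem P1_ofReal (n : ℕ) (τ : ℂ) (y : Fin (2 * n) → ℝ) :
    P1 n τ (fun i => y i) =
      (∏ i, ∏ j, if i < j then
        xOf (y j) ^ 3 / xOf (y i) ^ 3 * entryDen τ (y i - y j) else 1) *
      pf (fun i j => entryNum τ (y i - y j) / entryDen τ (y i - y j)) := by
  simp only [P1, entryNum, entryDen, ofReal_sub, xOf_sub, div_pow]

end Entries

section Configuration

variable {n : ℕ} {τ : ℂ}

/-- Real points grouped in `n` pairs, with difference `1 / 6 + t` inside each pair. -/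
def pairedPoint (n : ℕ) (t : ℝ) (a : Fin n × Fin 2) : ℝ :=
  (a.1 : ℕ) / (6 * n) + if a.2 = 0 then 1 / 6 + t else 0

theorem continuous_pairedPoint (a : Fin n × Fin 2) : Continuous fun t => pairedPoint n t a := by
  unfold pairedPoint
  split_ifs <;> fun_prop

theorem entryDen_pairedPoint_zero_ne_zero (hτ : 0 < τ.im) {a b : Fin n × Fin 2}
    (hab : a.1 ≠ b.1) : entryDen τ (pairedPoint n 0 a - pairedPoint n 0 b) ≠ 0 := by
  rw [Ne, entryDen_eq_zero_iff hτ]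
  rintro ⟨k, hk⟩
  have hn : (n : ℝ) ≠ 0 := by exact_mod_cast (a.1.pos).ne'
  obtain ⟨c, hc⟩ : ∃ c : ℤ, ((a.1 : ℕ) : ℝ) - (b.1 : ℕ) = n * c := by
    refine ⟨2 * k + 1 - (if a.2 = 0 then 1 else 0) + (if b.2 = 0 then 1 else 0), ?_⟩
    unfold pairedPoint at hk
    push_cast
    split_ifs at hk ⊢ <;> field_simp at hk <;> linarith
  have hc' : ((a.1 : ℕ) : ℤ) - (b.1 : ℕ) = n * c := by exact_mod_cast hc
  have ha := a.1.isLt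
  have hb := b.1.isLt
  have h0 : ((a.1 : ℕ) : ℤ) - (b.1 : ℕ) = 0 :=
    Int.eq_zero_of_abs_lt_dvd ⟨c, hc'⟩ (by rw [abs_lt]; omega)
  exact hab (Fin.ext (by omega))

theorem pairedPoint_sub (t : ℝ) (j : Fin n) :
    pairedPoint n t (j, 0) - pairedPoint n t (j, 1) = 1 / 6 + t := by
  simp [pairedPoint]

theorem eventually_entryDen_pairedPoint_ne_zero (hτ : 0 < τ.im) {a b : Fin n × Fin 2}
    (hab : a ≠ b) :
    ∀ᶠ t in 𝓝[≠] 0, entryDen τ (pairedPoint n t a - pairedPoint n t b) ≠ 0 := by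
  obtain ⟨j, u⟩ := a
  obtain ⟨k, v⟩ := b
  by_cases h : j = k
  · subst h
    have hsixth := eventually_entryDen_sixth_add_ne_zero hτ
    fin_cases u <;> fin_cases v
    · exact absurd rfl hab
    · simpa [pairedPoint_sub] using hsixth
    · filter_upwards [hsixth] with t ht
      show entryDen τ (pairedPoint n t (j, 1) - pairedPoint n t (j, 0)) ≠ 0
      rw [← neg_sub, pairedPoint_sub, entryDen_neg hτ]
      exact mul_ne_zero (inv_ne_zero (pow_ne_zero 6 (xOf_ne_zero _))) ht
    · exact absurd rfl hab
  · have hcont := (continuous_entryDen hτ).comp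
      ((continuous_pairedPoint (j, u)).sub (continuous_pairedPoint (k, v)))
    exact eventually_nhdsWithin_of_eventually_nhds
      (hcont.continuousAt.eventually_ne (entryDen_pairedPoint_zero_ne_zero hτ h))

theorem tendsto_entry_pairedPoint (hτ : 0 < τ.im) (a b : Fin n × Fin 2) :
    Tendsto (fun t => entryDen τ (1 / 6 + t) / entryNum τ (1 / 6 + t) *
      (entryNum τ (pairedPoint n t a - pairedPoint n t b) /
        entryDen τ (pairedPoint n t a - pairedPoint n t b)))
      (𝓝[≠] 0) (𝓝 (blockSymplectic a b)) := by
  have hshift : Continuous fun t : ℝ => 1 / 6 + t := by fun_prop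
  have hnum := (continuous_entryNum hτ).comp hshift
  have hnum0 : entryNum τ (1 / 6 + 0) ≠ 0 := by
    rw [add_zero]; exact entryNum_sixth_ne_zero hτ
  have hnum_ne : ∀ᶠ t : ℝ in 𝓝[≠] 0, entryNum τ (1 / 6 + t) ≠ 0 :=
    eventually_nhdsWithin_of_eventually_nhds (hnum.continuousAt.eventually_ne hnum0)
  have hratio : ∀ᶠ t : ℝ in 𝓝[≠] 0, entryDen τ (1 / 6 + t) / entryNum τ (1 / 6 + t) *
      (entryNum τ (1 / 6 + t) / entryDen τ (1 / 6 + t)) = 1 := by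
    filter_upwards [hnum_ne, eventually_entryDen_sixth_add_ne_zero hτ] with t h1 h2
    rw [div_mul_div_cancel₀ h1, div_self h2]
  have hr : Tendsto (fun t => entryDen τ (1 / 6 + t) / entryNum τ (1 / 6 + t))
      (𝓝[≠] 0) (𝓝 0) := by
    have h := ((((continuous_entryDen hτ).comp hshift).continuousAt (x := 0)).div
      hnum.continuousAt hnum0).tendsto
    simp only [Pi.div_apply, Function.comp_apply, add_zero, entryDen_sixth hτ, zero_div] at h
    exact h.mono_left nhdsWithin_le_nhds
  have hreg : entryDen τ (pairedPoint n 0 a - pairedPoint n 0 b) ≠ 0 →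
      Tendsto (fun t => entryDen τ (1 / 6 + t) / entryNum τ (1 / 6 + t) *
        (entryNum τ (pairedPoint n t a - pairedPoint n t b) /
          entryDen τ (pairedPoint n t a - pairedPoint n t b))) (𝓝[≠] 0) (𝓝 0) := by
    intro h
    have hd := (continuous_pairedPoint a).sub (continuous_pairedPoint b)
    have hlim := (((continuous_entryNum hτ).comp hd).continuousAt (x := 0)).div
      ((continuous_entryDen hτ).comp hd).continuousAt h
    simpa using hr.mul (hlim.tendsto.mono_left nhdsWithin_le_nhds)
  obtain ⟨j, u⟩ := a
  obtain ⟨k, v⟩ := b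
  by_cases h : j = k
  · subst h
    have hdiag : ∀ w : Fin 2,
        entryDen τ (pairedPoint n 0 (j, w) - pairedPoint n 0 (j, w)) ≠ 0 := by
      intro w
      rw [sub_self, Ne, entryDen_eq_zero_iff hτ]
      rintro ⟨k, hk⟩
      have : (0 : ℤ) = 2 * k + 1 := by
        rw [mul_zero] at hk
        exact_mod_cast hk
      omega
    fin_cases u <;> fin_cases v
    · simpa [blockSymplectic] using hreg (hdiag 0)
    · refine tendsto_const_nhds.congr' (hratio.mono fun t ht => ?_)
      simpa [blockSymplectic, pairedPoint_sub] using ht.symm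
    · refine tendsto_const_nhds.congr' (hratio.mono fun t ht => ?_)
      show _ = _ * (entryNum τ (pairedPoint n t (j, 1) - pairedPoint n t (j, 0)) /
        entryDen τ (pairedPoint n t (j, 1) - pairedPoint n t (j, 0)))
      rw [← neg_sub (pairedPoint n t (j, 0)), pairedPoint_sub, entryNum_div_entryDen_neg hτ,
        mul_neg, ht]
      simp [blockSymplectic]
    · simpa [blockSymplectic] using hreg (hdiag 1)
  · simpa [blockSymplectic, h] using
      hreg (entryDen_pairedPoint_zero_ne_zero hτ (a := (j, u)) (b := (k, v)) h)

end Configuration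

theorem stmt4 (n : ℕ) (hn : 1 ≤ n) (τ : ℂ) (hτ : 0 < τ.im) :
    ∃ z : Fin (2 * n) → ℂ, P1 n τ z ≠ 0 := by
  let y : ℝ → Fin (2 * n) → ℝ := fun t i => pairedPoint n t ((pairIndex n).symm i)
  have hpf : ∀ᶠ t in 𝓝[≠] (0 : ℝ), pf (fun i j : Fin (2 * n) =>
      entryNum τ (y t i - y t j) / entryDen τ (y t i - y t j)) ≠ 0 :=
    eventually_pf_ne_zero fun a b => by
      simpa only [y, Equiv.symm_apply_apply] using tendsto_entry_pairedPoint hτ a b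
  have hden : ∀ᶠ t in 𝓝[≠] (0 : ℝ), ∀ i j : Fin (2 * n), i ≠ j →
      entryDen τ (y t i - y t j) ≠ 0 := by
    simp only [eventually_all]
    exact fun i j hij =>
      eventually_entryDen_pairedPoint_ne_zero hτ ((pairIndex n).symm.injective.ne hij)
  obtain ⟨t, hpf, hden⟩ := (hpf.and hden).exists
  refine ⟨fun i => y t i, ?_⟩
  rw [P1_ofReal]
  refine mul_ne_zero (Finset.prod_ne_zero_iff.2 fun i _ => Finset.prod_ne_zero_iff.2 fun j _ => ?_)
    hpf
  split_ifs with hij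
  · exact mul_ne_zero (div_ne_zero (pow_ne_zero 3 (xOf_ne_zero _))
      (pow_ne_zero 3 (xOf_ne_zero _))) (hden i j hij.ne)
  · exact one_ne_zero

end
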